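/- arXiv:0708.1481 — 3 statements merged into one kernel-verified Lean document; each statement's English description precedes it below -/
import Mathlib

section
/- Let K be a field, m < n, J ⊂ S' = K[x_1,...,x_m] a monomial ideal, S = K[x_1,...,x_n], I = JS, and fix k with m < k ≤ n. Let T = K[x_1,...,x_{k−1},x_{k+1},...,x_n] and L = JT. Suppose I^c = ⊕_{i=1}^s v_i K[W_i] is a Stanley decomposition of S/I. Then: (1) for each i, the intersection v_i K[W_i] ∩ T equals v_i K[W_i ∖ {x_k}] if x_k does not divide v_i, and equals {0} otherwise; and (2) L^c = ⊕_{i ∈ 𝓘} v_i K[W_i] ∩ T is a Stanley decomposition of T/L, where 𝓘 = { i : v_i K[W_i] ∩ T ≠ {0} }. -/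
/-!
STATEMENT 8 (from the proof of Lemma 1.2): Let `K` be a field, `m < n`,
`J ⊂ S' = K[x_1,…,x_m]` a monomial ideal, `S = K[x_1,…,x_n]`, `I = JS`, and fix
`k` with `m < k ≤ n`.  Let `T = K[x_1,…,x_{k−1},x_{k+1},…,x_n]` (regarded as a
`K`-subspace of `S`) and `L = JT`.  Suppose `I^c = ⊕_{i=1}^s v_i K[W_i]` is a
Stanley decomposition of `S/I`.  Then:
(1) for each `i`, `v_i K[W_i] ∩ T = v_i K[W_i ∖ {x_k}]` if `x_k ∤ v_i`, and `= 0` otherwise;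
(2) `L^c = ⊕_{i ∈ 𝓘} (v_i K[W_i] ∩ T)` is a Stanley decomposition of `T/L`, where
`𝓘 = { i : v_i K[W_i] ∩ T ≠ 0 }` (i.e. the family is independent and its sum is `L^c`).
-/

open MvPolynomial

noncomputable section

variable (K : Type*) [Field K]

/-- A monomial ideal: an ideal generated by monomials. -/
def IsMonomialIdeal {σ : Type*} (I : Ideal (MvPolynomial σ K)) : Prop :=
  ∃ A : Set (σ →₀ ℕ),
    I = Ideal.span ((fun d => (monomial d (1 : K) : MvPolynomial σ K)) '' A)

/-- The Stanley space `u·K[Z]`: the `K`-subspace spanned by all monomials `u·v`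
where `v` is a monomial in the variables of `Z`. -/
def stanleySpace {σ : Type*} (u : σ →₀ ℕ) (Z : Finset σ) : Submodule K (MvPolynomial σ K) :=
  Submodule.span K
    ((fun e => (monomial (u + e) (1 : K) : MvPolynomial σ K)) ''
      {e : σ →₀ ℕ | ∀ i ∉ Z, e i = 0})

/-- `I^c`: the `K`-subspace spanned by all monomials not belonging to `I`. -/
def monomialComplement {σ : Type*} (I : Ideal (MvPolynomial σ K)) :
    Submodule K (MvPolynomial σ K) :=
  Submodule.span K
    {f : MvPolynomial σ K | ∃ d : σ →₀ ℕ, f = monomial d (1 : K) ∧ f ∉ I}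

/-- The polynomial subring `T = K[x_i : i ≠ k]` of `S = K[x_1,…,x_n]`, regarded as a
`K`-subspace of `S`: the range of the renaming embedding. -/
def tSubspace {n : ℕ} (k : Fin n) : Submodule K (MvPolynomial (Fin n) K) :=
  LinearMap.range (rename (Subtype.val : {i : Fin n // i ≠ k} → Fin n) :
    MvPolynomial {i : Fin n // i ≠ k} K →ₐ[K] MvPolynomial (Fin n) K).toLinearMap

section MonomialSpan

variable (R : Type*) [CommSemiring R] {σ τ : Type*}

/-- Spans of monomials with prescribed exponents intersect along the common exponents. -/
lemma restrictSupport_inf (s t : Set (σ →₀ ℕ)) :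
    restrictSupport R s ⊓ restrictSupport R t = restrictSupport R (s ∩ t) := by
  ext p
  simp [mem_restrictSupport_iff]

lemma iSup_restrictSupport {ι : Sort*} (s : ι → Set (σ →₀ ℕ)) :
    ⨆ i, restrictSupport R (s i) = restrictSupport R (⋃ i, s i) := by
  simp only [restrictSupport_eq_span, Set.image_iUnion, Submodule.span_iUnion]

/-- Renaming the variables of a span of monomials renames its exponents. -/
lemma map_rename_restrictSupport (f : σ → τ) (s : Set (σ →₀ ℕ)) :
    (restrictSupport R s).map (rename f : MvPolynomial σ R →ₐ[R] MvPolynomial τ R).toLinearMap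
      = restrictSupport R (Finsupp.mapDomain f '' s) := by
  simp only [restrictSupport_eq_span, Submodule.map_span, Set.image_image,
    AlgHom.toLinearMap_apply, rename_monomial]

variable {R}

/-- Extending an ideal along an injective renaming and contracting it back changes nothing. -/
lemma rename_mem_map_rename_iff {f : σ → τ}
    (hf : Function.Injective f) (I : Ideal (MvPolynomial σ R)) (p : MvPolynomial σ R) :
    rename f p ∈ I.map (rename f : MvPolynomial σ R →ₐ[R] MvPolynomial τ R) ↔ p ∈ I := by
  refine ⟨fun h => ?_, Ideal.mem_map_of_mem _⟩
  have hle : I.map (rename f : MvPolynomial σ R →ₐ[R] MvPolynomial τ R)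
      ≤ I.comap (killCompl hf : MvPolynomial τ R →ₐ[R] MvPolynomial σ R) := by
    rw [Ideal.map_le_iff_le_comap]
    intro q hq
    simpa [Ideal.mem_comap, killCompl_rename_app] using hq
  simpa [Ideal.mem_comap, killCompl_rename_app] using hle h

end MonomialSpan

lemma stanleySpace_eq_restrictSupport {σ : Type*} (u : σ →₀ ℕ) (Z : Finset σ) :
    stanleySpace K u Z = restrictSupport K ((u + ·) '' {e : σ →₀ ℕ | ∀ i ∉ Z, e i = 0}) := by
  rw [restrictSupport_eq_span, Set.image_image, stanleySpace]

lemma monomialComplement_eq_restrictSupport {σ : Type*} (I : Ideal (MvPolynomial σ K)) :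
    monomialComplement K I = restrictSupport K {d | monomial d (1 : K) ∉ I} := by
  rw [restrictSupport_eq_span, monomialComplement]
  congr 1
  ext p
  constructor
  · rintro ⟨d, rfl, hd⟩
    exact ⟨d, hd, rfl⟩
  · rintro ⟨d, hd, rfl⟩
    exact ⟨d, rfl, hd⟩

lemma mapDomain_val_apply_self {σ : Type*} (k : σ) (d : {i : σ // i ≠ k} →₀ ℕ) :
    d.mapDomain Subtype.val k = 0 :=
  Finsupp.mapDomain_of_notMem_range _ _ (by simp)

lemma exists_mapDomain_val_eq {σ : Type*} {k : σ} {d : σ →₀ ℕ} (hd : d k = 0) :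
    ∃ e : {i : σ // i ≠ k} →₀ ℕ, e.mapDomain Subtype.val = d := by
  refine ⟨_, Finsupp.mapDomain_comapDomain _ Subtype.val_injective d fun i hi => ?_⟩
  have hik : i ≠ k := by
    rintro rfl
    exact Finsupp.mem_support_iff.mp hi hd
  exact ⟨⟨i, hik⟩, rfl⟩

lemma tSubspace_eq_restrictSupport {n : ℕ} (k : Fin n) :
    tSubspace K k = restrictSupport K {d | d k = 0} := by
  rw [tSubspace, LinearMap.range_eq_map, ← restrictSupport_univ K, map_rename_restrictSupport]
  congr 1
  ext d
  constructor
  · rintro ⟨e, -, rfl⟩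
    exact mapDomain_val_apply_self k e
  · intro hd
    obtain ⟨e, rfl⟩ := exists_mapDomain_val_eq hd
    exact ⟨e, trivial, rfl⟩

/-- The part of a Stanley space not involving `x_k`. -/
lemma stanleySpace_inf_tSubspace {n : ℕ} (k : Fin n) (u : Fin n →₀ ℕ) (Z : Finset (Fin n)) :
    stanleySpace K u Z ⊓ tSubspace K k
      = if u k = 0 then stanleySpace K u (Z.erase k) else ⊥ := by
  simp only [stanleySpace_eq_restrictSupport, tSubspace_eq_restrictSupport, restrictSupport_inf]
  split_ifs with hu
  · congr 1
    ext d
    constructor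
    · rintro ⟨⟨e, he, rfl⟩, hd⟩
      refine ⟨e, fun i hi => ?_, rfl⟩
      by_cases hik : i = k
      · subst hik
        exact (Nat.add_eq_zero_iff.mp hd).2
      · exact he i fun hiZ => hi (Finset.mem_erase.mpr ⟨hik, hiZ⟩)
    · rintro ⟨e, he, rfl⟩
      refine ⟨⟨e, fun i hi => he i fun h => hi (Finset.mem_of_mem_erase h), rfl⟩, ?_⟩
      simp [hu, he k (Finset.notMem_erase k Z)]
  · rw [eq_bot_iff, restrictSupport_eq_span, Submodule.span_le]
    rintro _ ⟨_, ⟨⟨e, -, rfl⟩, hd⟩, rfl⟩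
    exact absurd (Nat.add_eq_zero_iff.mp hd).1 hu

/-- The part of `(LS)^c` not involving `x_k` is `L^c`. -/
lemma monomialComplement_map_inf_tSubspace {n : ℕ} (k : Fin n)
    (L : Ideal (MvPolynomial {i : Fin n // i ≠ k} K)) :
    monomialComplement K (L.map (rename (Subtype.val : {i : Fin n // i ≠ k} → Fin n) :
        MvPolynomial {i : Fin n // i ≠ k} K →ₐ[K] MvPolynomial (Fin n) K)) ⊓ tSubspace K k
      = (monomialComplement K L).map
          (rename (Subtype.val : {i : Fin n // i ≠ k} → Fin n) :
            MvPolynomial {i : Fin n // i ≠ k} K →ₐ[K] MvPolynomial (Fin n) K).toLinearMap := by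
  simp only [monomialComplement_eq_restrictSupport, tSubspace_eq_restrictSupport,
    restrictSupport_inf, map_rename_restrictSupport]
  have hmem (e : {i : Fin n // i ≠ k} →₀ ℕ) :=
    rename_mem_map_rename_iff Subtype.val_injective L (monomial e 1)
  simp only [rename_monomial] at hmem
  congr 1
  ext d
  constructor
  · rintro ⟨hdI, hd⟩
    obtain ⟨e, rfl⟩ := exists_mapDomain_val_eq hd
    exact ⟨e, fun h => hdI ((hmem e).mpr h), rfl⟩
  · rintro ⟨e, he, rfl⟩
    exact ⟨fun h => he ((hmem e).mp h), mapDomain_val_apply_self k e⟩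

theorem stanley_decomposition_restrict {K : Type*} [Field K] {m n : ℕ} (hmn : m < n)
    (J : Ideal (MvPolynomial (Fin m) K)) (hJ : IsMonomialIdeal K J) (hJproper : J ≠ ⊤)
    (k : Fin n) (hk : m ≤ k.val)
    -- `I = JS`:
    (I : Ideal (MvPolynomial (Fin n) K))
    (hIdef : I = Ideal.map
      (rename (Fin.castLE hmn.le) : MvPolynomial (Fin m) K →ₐ[K] MvPolynomial (Fin n) K) J)
    -- `L = JT`, with `T` modelled as the polynomial ring in the variables `≠ x_k`:
    (L : Ideal (MvPolynomial {i : Fin n // i ≠ k} K))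
    (hLdef : L = Ideal.map
      (rename (fun j : Fin m =>
          (⟨Fin.castLE hmn.le j, Fin.ne_of_val_ne (by have := j.isLt; simp; omega)⟩ :
            {i : Fin n // i ≠ k})) :
        MvPolynomial (Fin m) K →ₐ[K] MvPolynomial {i : Fin n // i ≠ k} K) J)
    -- a Stanley decomposition `I^c = ⊕_{i=1}^s v_i K[W_i]` of `S/I`:
    (s : ℕ) (v : Fin s → (Fin n →₀ ℕ)) (W : Fin s → Finset (Fin n))
    (hindep : iSupIndep fun i => stanleySpace K (v i) (W i))
    (hsup : ⨆ i, stanleySpace K (v i) (W i) = monomialComplement K I) :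
    -- (1)
    (∀ i, stanleySpace K (v i) (W i) ⊓ tSubspace K k
        = if (v i) k = 0 then stanleySpace K (v i) ((W i).erase k) else ⊥)
    -- (2)
    ∧ iSupIndep (fun i : {i : Fin s // stanleySpace K (v i) (W i) ⊓ tSubspace K k ≠ ⊥} =>
        stanleySpace K (v i.1) (W i.1) ⊓ tSubspace K k)
    ∧ (⨆ i : {i : Fin s // stanleySpace K (v i) (W i) ⊓ tSubspace K k ≠ ⊥},
          stanleySpace K (v i.1) (W i.1) ⊓ tSubspace K k)
        = Submodule.map
            (rename (Subtype.val : {i : Fin n // i ≠ k} → Fin n) :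
              MvPolynomial {i : Fin n // i ≠ k} K →ₐ[K] MvPolynomial (Fin n) K).toLinearMap
            (monomialComplement K L) := by
  have hIL : I = L.map (rename (Subtype.val : {i : Fin n // i ≠ k} → Fin n) :
      MvPolynomial {i : Fin n // i ≠ k} K →ₐ[K] MvPolynomial (Fin n) K) := by
    rw [hIdef, hLdef, Ideal.map_mapₐ]
    congr 1
    ext j
    simp
  refine ⟨fun i => stanleySpace_inf_tSubspace K k (v i) (W i), ?_, ?_⟩
  · exact (hindep.mono fun i => inf_le_left).comp Subtype.val_injective
  · rw [iSup_ne_bot_subtype fun i => stanleySpace K (v i) (W i) ⊓ tSubspace K k,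
      ← monomialComplement_map_inf_tSubspace, ← hIL, ← hsup]
    simp only [stanleySpace_eq_restrictSupport, tSubspace_eq_restrictSupport,
      restrictSupport_inf, iSup_restrictSupport, Set.iUnion_inter]

end
end

section
/- Let K be a field, m < n, J ⊂ S' = K[x_1,...,x_m] a monomial ideal, S = K[x_1,...,x_n], and I = JS. Let w be a monomial in the variables x_{m+1},...,x_n and suppose x_k divides w for some m < k ≤ n. Then there is an isomorphism of S-modules (I, w/x_k)/(I, w) ≅ S/(I, x_k). -/
/-!
STATEMENT 9 (from the proof of Theorem 1.1): Let `K` be a field, `m < n`,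
`J ⊂ S' = K[x_1,…,x_m]` a monomial ideal, `S = K[x_1,…,x_n]`, `I = JS`.  Let `w`
be a monomial in the variables `x_{m+1},…,x_n` with `x_k ∣ w` for some
`m < k ≤ n`.  Then `(I, w/x_k)/(I, w) ≅ S/(I, x_k)` as `S`-modules.
-/

open MvPolynomial

noncomputable section

variable (K : Type*) [Field K]

/-- If `v` is a nonzerodivisor modulo `I`, then multiplication by `v` induces an isomorphism
`R ⧸ (I, x) ≃ (I, v) ⧸ (I, v * x)`. -/
theorem Ideal.nonempty_sup_span_quotient_linearEquiv {R : Type*} [CommRing R] (I : Ideal R)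
    (v x : R) (hv : ∀ a, a * v ∈ I → a ∈ I) :
    Nonempty (
      (↥(I ⊔ Ideal.span {v}) ⧸
          Submodule.comap (I ⊔ Ideal.span {v}).subtype (I ⊔ Ideal.span {v * x}))
        ≃ₗ[R] (R ⧸ (I ⊔ Ideal.span {x}))) := by
  have hmem : ∀ a : R, LinearMap.mulRight R v a ∈ I ⊔ Ideal.span {v} := fun a =>
    Ideal.mem_sup_right (Ideal.mem_span_singleton'.2 ⟨a, rfl⟩)
  let f := (Submodule.mkQ (Submodule.comap (I ⊔ Ideal.span {v}).subtype
    (I ⊔ Ideal.span {v * x}))).comp ((LinearMap.mulRight R v).codRestrict _ hmem)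
  have hf : Function.Surjective f := by
    intro y
    obtain ⟨⟨y, hy⟩, rfl⟩ := Submodule.mkQ_surjective _ y
    obtain ⟨i, hi, z, hz, rfl⟩ := Submodule.mem_sup.1 hy
    obtain ⟨a, rfl⟩ := Ideal.mem_span_singleton'.1 hz
    refine ⟨a, (Submodule.Quotient.eq _).2 ?_⟩
    refine Ideal.mem_sup_left ?_
    simpa using hi
  have hker : LinearMap.ker f = I ⊔ Ideal.span {x} := by
    ext a
    have hfa : a ∈ LinearMap.ker f ↔ a * v ∈ I ⊔ Ideal.span {v * x} := by
      rw [LinearMap.mem_ker]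
      exact Submodule.Quotient.mk_eq_zero _
    rw [hfa]
    constructor
    · intro h
      obtain ⟨i, hi, z, hz, h⟩ := Submodule.mem_sup.1 h
      obtain ⟨c, rfl⟩ := Ideal.mem_span_singleton'.1 hz
      refine Submodule.mem_sup.2 ⟨a - c * x, hv _ ?_, c * x,
        Ideal.mem_span_singleton'.2 ⟨c, rfl⟩, by ring⟩
      convert hi using 1
      linear_combination -h
    · intro h
      obtain ⟨i, hi, z, hz, rfl⟩ := Submodule.mem_sup.1 h
      obtain ⟨c, rfl⟩ := Ideal.mem_span_singleton'.1 hz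
      exact Submodule.mem_sup.2 ⟨i * v, I.mul_mem_right v hi, c * (v * x),
        Ideal.mem_span_singleton'.2 ⟨c, rfl⟩, by ring⟩
  exact ⟨((Submodule.quotEquivOfEq _ _ hker.symm).trans
    (f.quotKerEquivOfSurjective hf)).symm⟩

/-- A monomial in variables outside the range of `e` is a nonzerodivisor modulo an ideal generated
by monomials in the variables in the range of `e`. -/
theorem MvPolynomial.mem_map_rename_of_mul_monomial_mem {K σ τ : Type*} [Field K] (e : σ → τ)
    {J : Ideal (MvPolynomial σ K)} (hJ : IsMonomialIdeal K J) (c : τ →₀ ℕ)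
    (hc : ∀ i, c (e i) = 0) {a : MvPolynomial τ K}
    (ha : a * monomial c 1 ∈ J.map (rename e : MvPolynomial σ K →ₐ[K] MvPolynomial τ K)) :
    a ∈ J.map (rename e : MvPolynomial σ K →ₐ[K] MvPolynomial τ K) := by
  obtain ⟨A, rfl⟩ := hJ
  have himage : (rename e : MvPolynomial σ K →ₐ[K] MvPolynomial τ K) ''
      ((fun d => monomial d (1 : K)) '' A) =
      (fun d => monomial d (1 : K)) '' (Finsupp.mapDomain e '' A) := by
    simp [Set.image_image, rename_monomial]
  rw [Ideal.map_span, himage, mem_ideal_span_monomial_image] at ha ⊢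
  intro d hd
  obtain ⟨_, ⟨g, hg, rfl⟩, hle⟩ := ha (d + c) (by
    rw [mem_support_iff, coeff_mul_monomial, mul_one]
    exact mem_support_iff.1 hd)
  refine ⟨_, ⟨g, hg, rfl⟩, fun i => ?_⟩
  by_cases hi : i ∈ Set.range e
  · obtain ⟨j, rfl⟩ := hi
    simpa [hc j] using hle (e j)
  · simp [Finsupp.mapDomain_of_notMem_range g i hi]

theorem quotient_iso_of_divide_by_variable {K : Type*} [Field K] {m n : ℕ} (hmn : m < n)
    (J : Ideal (MvPolynomial (Fin m) K)) (hJ : IsMonomialIdeal K J) (hJproper : J ≠ ⊤)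
    (I : Ideal (MvPolynomial (Fin n) K))
    (hIdef : I = Ideal.map
      (rename (Fin.castLE hmn.le) : MvPolynomial (Fin m) K →ₐ[K] MvPolynomial (Fin n) K) J)
    -- `w = x^b` is a monomial in the variables `x_{m+1},…,x_n`:
    (b : Fin n →₀ ℕ) (hb : ∀ i : Fin n, i.val < m → b i = 0)
    -- `x_k` divides `w` for some `m < k ≤ n`:
    (k : Fin n) (hk : m ≤ k.val) (hdvd : 1 ≤ b k) :
    Nonempty (
      (↥(I ⊔ Ideal.span {(monomial (b - Finsupp.single k 1) (1 : K) : MvPolynomial (Fin n) K)}) ⧸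
          (Submodule.comap
            (I ⊔ Ideal.span
              {(monomial (b - Finsupp.single k 1) (1 : K) : MvPolynomial (Fin n) K)}).subtype
            (I ⊔ Ideal.span {(monomial b (1 : K) : MvPolynomial (Fin n) K)})))
        ≃ₗ[MvPolynomial (Fin n) K]
      (MvPolynomial (Fin n) K ⧸ (I ⊔ Ideal.span {(X k : MvPolynomial (Fin n) K)}))) := by
  subst hIdef
  have hw : (monomial b (1 : K) : MvPolynomial (Fin n) K) =
      monomial (b - Finsupp.single k 1) 1 * X k := by
    rw [X, monomial_mul, one_mul, tsub_add_cancel_of_le (Finsupp.single_le_iff.2 hdvd)]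
  rw [hw]
  refine Ideal.nonempty_sup_span_quotient_linearEquiv _ _ _ fun a ha =>
    mem_map_rename_of_mul_monomial_mem _ hJ _ (fun i => ?_) ha
  simp [hb (Fin.castLE hmn.le i) i.isLt]

end
end

section
/- Let K be a field, m < n, J ⊂ S' = K[x_1,...,x_m] a monomial ideal, S = K[x_1,...,x_n], I = JS, and let u ≠ 1 be a monomial whose support is contained in {x_{m+1},...,x_n} (so that u is regular on S/I). Then Ass(S/(I,u)) = { (P'S, x_k) : P' ∈ Ass(S'/J), x_k divides u }. -/
/-!
STATEMENT 13 (from the proof of Theorem 2.1): Let `K` be a field, `m < n`,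
`J ⊂ S' = K[x_1,…,x_m]` a monomial ideal, `S = K[x_1,…,x_n]`, `I = JS`, and let
`u ≠ 1` be a monomial with support in `{x_{m+1},…,x_n}` (so `u` is regular on
`S/I`).  Then `Ass(S/(I,u)) = { (P'S, x_k) : P' ∈ Ass(S'/J), x_k ∣ u }`.
-/

open MvPolynomial

noncomputable section

variable (K : Type*) [Field K]

/-- Over a Noetherian ring, an associated prime of `R ⧸ I` is a prime of the form `(I : f)`. -/
theorem mem_associatedPrimes_quotient_iff {R : Type*} [CommRing R] [IsNoetherianRing R]
    (I Q : Ideal R) :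
    Q ∈ associatedPrimes R (R ⧸ I) ↔ Q.IsPrime ∧ ∃ f : R, ∀ g, g ∈ Q ↔ g * f ∈ I := by
  rw [AssociatedPrimes.mem_iff, isAssociatedPrime_iff]
  refine and_congr_right fun _ => ⟨?_, ?_⟩
  · rintro ⟨x, hx⟩
    obtain ⟨f, rfl⟩ := Ideal.Quotient.mk_surjective x
    refine ⟨f, fun g => ?_⟩
    rw [hx, Submodule.mem_colon_singleton, Submodule.mem_bot, ← Ideal.Quotient.eq_zero_iff_mem,
      map_mul, Algebra.smul_def, Ideal.Quotient.algebraMap_eq]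
  · rintro ⟨f, hf⟩
    refine ⟨Ideal.Quotient.mk I f, ?_⟩
    ext g
    rw [hf, Submodule.mem_colon_singleton, Submodule.mem_bot, ← Ideal.Quotient.eq_zero_iff_mem,
      map_mul, Algebra.smul_def, Ideal.Quotient.algebraMap_eq]

theorem map_mem_associatedPrimes_quotient {R R' : Type*} [CommRing R] [IsNoetherianRing R]
    [CommRing R'] [IsNoetherianRing R'] (e : R ≃+* R') {I Q : Ideal R}
    (h : Q ∈ associatedPrimes R (R ⧸ I)) :
    Q.map e ∈ associatedPrimes R' (R' ⧸ I.map e) := by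
  rw [mem_associatedPrimes_quotient_iff] at h ⊢
  obtain ⟨hQ, f, hf⟩ := h
  refine ⟨Ideal.map_isPrime_of_equiv e, e f, fun g => ?_⟩
  obtain ⟨g, rfl⟩ := e.surjective g
  rw [← map_mul]
  have key (L : Ideal R) (x : R) : e x ∈ L.map e ↔ x ∈ L := by
    rw [Ideal.mem_map_of_equiv]
    exact ⟨fun ⟨y, hy, hxy⟩ => e.injective hxy ▸ hy, fun hx => ⟨x, hx, rfl⟩⟩
  rw [key, key, hf]

section PolynomialExtension

variable {A τ : Type*} [CommRing A]

theorem mem_map_C_sup_span_monomial_iff (J : Ideal A) (b : τ →₀ ℕ) (g : MvPolynomial τ A) :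
    g ∈ J.map C ⊔ Ideal.span {monomial b (1 : A)} ↔ ∀ d, ¬ b ≤ d → coeff d g ∈ J := by
  classical
  constructor
  · intro hg d hd
    obtain ⟨x, hx, y, hy, rfl⟩ := Submodule.mem_sup.mp hg
    obtain ⟨z, rfl⟩ := Ideal.mem_span_singleton'.mp hy
    rw [coeff_add, coeff_mul_monomial', if_neg hd, add_zero]
    exact mem_map_C_iff.mp hx d
  · intro hg
    rw [g.as_sum]
    refine Ideal.sum_mem _ fun d _ => ?_
    by_cases hd : b ≤ d
    · refine Ideal.mem_sup_right (Ideal.mem_span_singleton'.mpr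
        ⟨monomial (d - b) (coeff d g), ?_⟩)
      rw [monomial_mul, tsub_add_cancel_of_le hd, mul_one]
    · refine Ideal.mem_sup_left (mem_map_C_iff.mpr fun e => ?_)
      rw [coeff_monomial]
      split_ifs
      · exact hg d hd
      · exact J.zero_mem

theorem mem_map_C_sup_span_X_iff (J : Ideal A) (k : τ) (g : MvPolynomial τ A) :
    g ∈ J.map C ⊔ Ideal.span {(X k : MvPolynomial τ A)} ↔ ∀ d, d k = 0 → coeff d g ∈ J := by
  rw [X, mem_map_C_sup_span_monomial_iff]
  refine forall_congr' fun d => ?_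
  rw [Finsupp.single_le_iff, Nat.one_le_iff_ne_zero, not_not]

theorem isPrime_map_C_sup_span_X (P : Ideal A) [P.IsPrime] (k : τ) :
    (P.map C ⊔ Ideal.span {(X k : MvPolynomial τ A)}).IsPrime := by
  have hX : (Ideal.span {(X k : MvPolynomial τ (A ⧸ P))}).IsPrime :=
    (Ideal.span_singleton_prime (X_ne_zero k)).mpr X_prime
  have h : P.map C ⊔ Ideal.span {(X k : MvPolynomial τ A)} =
      (Ideal.span {(X k : MvPolynomial τ (A ⧸ P))}).comap (map (Ideal.Quotient.mk P)) := by
    ext g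
    have h0 := mem_map_C_sup_span_X_iff (⊥ : Ideal (A ⧸ P)) k (map (Ideal.Quotient.mk P) g)
    rw [Ideal.map_bot, bot_sup_eq] at h0
    rw [Ideal.mem_comap, h0, mem_map_C_sup_span_X_iff]
    simp only [coeff_map, Ideal.mem_bot, Ideal.Quotient.eq_zero_iff_mem]
  rw [h]
  exact Ideal.comap_isPrime _ _

/-- If `(J : a) = P`, then `((J, Y ^ b) : a Y ^ (b - eₖ)) = (P, Yₖ)`. -/
theorem mul_monomial_mem_map_C_sup_span_monomial_iff {J P : Ideal A} {a : A}
    (ha : ∀ r, r ∈ P ↔ r * a ∈ J) {b : τ →₀ ℕ} {k : τ} (hk : 1 ≤ b k) (g : MvPolynomial τ A) :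
    g * monomial (b - Finsupp.single k 1) a ∈ J.map C ⊔ Ideal.span {monomial b (1 : A)} ↔
      g ∈ P.map C ⊔ Ideal.span {(X k : MvPolynomial τ A)} := by
  classical
  have hle : Finsupp.single k 1 ≤ b := Finsupp.single_le_iff.mpr hk
  have hb (d : τ →₀ ℕ) : b ≤ d + (b - Finsupp.single k 1) ↔ d k ≠ 0 := by
    rw [← tsub_le_iff_right, tsub_tsub_cancel_of_le hle, Finsupp.single_le_iff,
      Nat.one_le_iff_ne_zero]
  rw [mem_map_C_sup_span_monomial_iff, mem_map_C_sup_span_X_iff]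
  constructor
  · intro h d hd
    have := h (d + (b - Finsupp.single k 1)) (by rw [hb]; simpa using hd)
    rwa [coeff_mul_monomial, ← ha] at this
  · intro h d hd
    rw [coeff_mul_monomial']
    split_ifs with hbd
    · rw [← ha]
      apply h
      by_contra hne
      rw [← ne_eq, ← hb, tsub_add_cancel_of_le hbd] at hne
      exact hd hne
    · exact J.zero_mem

/-- Multiplying `f` by a suitable constant outside the prime `Q = ((J, Y ^ b) : f)`, one may assume
that each coefficient `c` of `f` at an exponent not above `b` satisfies
`c ∈ J` or `(J : c) = Q ∩ A`. -/
theorem exists_colon_coeff_eq_comap {J : Ideal A} {b : τ →₀ ℕ} {Q : Ideal (MvPolynomial τ A)}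
    [hQ : Q.IsPrime] {f : MvPolynomial τ A}
    (hf : ∀ g, g ∈ Q ↔ g * f ∈ J.map C ⊔ Ideal.span {monomial b (1 : A)}) :
    ∃ f' : MvPolynomial τ A,
      (∀ g, g ∈ Q ↔ g * f' ∈ J.map C ⊔ Ideal.span {monomial b (1 : A)}) ∧
      ∀ e, ¬ b ≤ e → coeff e f' ∉ J → ∀ r, r ∈ Q.comap C ↔ r * coeff e f' ∈ J := by
  classical
  have hP (r : A) (hr : r ∈ Q.comap C) (e : τ →₀ ℕ) (he : ¬ b ≤ e) : r * coeff e f ∈ J := by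
    have := (mem_map_C_sup_span_monomial_iff _ _ _).mp ((hf _).mp hr) e he
    rwa [coeff_C_mul] at this
  have hs (e : τ →₀ ℕ) : ∃ s : A, s ∉ Q.comap C ∧
      (s * coeff e f ∈ J ∨ ∀ r, r * coeff e f ∈ J → r ∈ Q.comap C) := by
    by_cases h : ∀ r, r * coeff e f ∈ J → r ∈ Q.comap C
    · exact ⟨1, (Ideal.ne_top_iff_one _).mp (Ideal.IsPrime.ne_top inferInstance), Or.inr h⟩
    · push Not at h
      obtain ⟨s, hs, hsQ⟩ := h
      exact ⟨s, hsQ, Or.inl hs⟩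
  choose s hsQ hs using hs
  have hprod : ∏ e ∈ f.support, s e ∉ Q.comap C := by
    rw [Ideal.IsPrime.prod_mem_iff]
    rintro ⟨e, -, he⟩
    exact hsQ e he
  set t := ∏ e ∈ f.support, s e
  refine ⟨C t * f, fun g => ?_, fun e hbe he r => ?_⟩
  · rw [← mul_assoc, ← hf]
    exact ⟨fun h => Q.mul_mem_right _ h, fun h => (hQ.mem_or_mem h).resolve_right hprod⟩
  · rw [coeff_C_mul] at he ⊢
    constructor
    · intro hr
      rw [mul_left_comm]
      exact J.mul_mem_left _ (hP r hr e hbe)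
    · intro hr
      have hes : e ∈ f.support := by
        by_contra h
        rw [notMem_support_iff.mp h, mul_zero] at he
        exact he J.zero_mem
      rcases hs e with h | h
      · obtain ⟨c, hc⟩ := Finset.dvd_prod_of_mem s hes
        refine absurd ?_ he
        rw [show t = s e * c from hc, mul_comm (s e), mul_assoc]
        exact J.mul_mem_left _ h
      · rw [← mul_assoc] at hr
        exact (Ideal.IsPrime.mem_or_mem inferInstance (h _ hr)).resolve_right hprod

/-- If `Yₖ` lies in `((J, Y ^ b) : f)` and each coefficient `c` of `f` at an exponent not above `b`
satisfies `c ∈ J` or `(J : c) = P`, then `((J, Y ^ b) : f)` is contained in `(P, Yₖ)`. -/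
theorem mem_map_C_sup_span_X_of_mul_mem {J P : Ideal A} {b : τ →₀ ℕ} {k : τ}
    {f g : MvPolynomial τ A}
    (hk : X k * f ∈ J.map C ⊔ Ideal.span {monomial b (1 : A)})
    (hP : ∀ e, ¬ b ≤ e → coeff e f ∉ J → ∀ r, r ∈ P ↔ r * coeff e f ∈ J)
    (hne : ∃ e, ¬ b ≤ e ∧ coeff e f ∉ J)
    (hg : g * f ∈ J.map C ⊔ Ideal.span {monomial b (1 : A)}) :
    g ∈ P.map C ⊔ Ideal.span {(X k : MvPolynomial τ A)} := by
  classical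
  rw [mem_map_C_sup_span_X_iff]
  by_contra! hcon
  obtain ⟨d₀, hd₀, hgd₀⟩ := hcon
  obtain ⟨e₀, he₀, hfe₀⟩ := hne
  have hXf (q : τ →₀ ℕ) (hq : coeff q f ∉ J) : b ≤ q + Finsupp.single k 1 := by
    by_contra h
    have := (mem_map_C_sup_span_monomial_iff _ _ _).mp hk _ h
    rw [mul_comm, coeff_mul_X] at this
    exact hq this
  have hcoord (q : τ →₀ ℕ) (hq : coeff q f ∉ J) (hbq : ¬ b ≤ q) : q k < b k := by
    by_contra! h
    refine hbq fun j => ?_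
    by_cases hj : j = k
    · exact hj ▸ h
    · simpa [Finsupp.single_apply, Ne.symm hj] using hXf q hq j
  let G := g.support.filter fun d => d k = 0 ∧ coeff d g ∉ P
  let F := f.support.filter fun e => ¬ b ≤ e ∧ coeff e f ∉ J
  have hG : G.Nonempty := ⟨d₀, Finset.mem_filter.mpr ⟨mem_support_iff.mpr fun h =>
    hgd₀ (h ▸ P.zero_mem), hd₀, hgd₀⟩⟩
  have hF : F.Nonempty := ⟨e₀, Finset.mem_filter.mpr ⟨mem_support_iff.mpr fun h =>
    hfe₀ (h ▸ J.zero_mem), he₀, hfe₀⟩⟩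
  obtain ⟨d, hd, e, he, huniq⟩ := UniqueSums.uniqueAdd_of_nonempty hG hF
  obtain ⟨-, hdk, hdP⟩ := Finset.mem_filter.mp hd
  obtain ⟨-, hbe, heJ⟩ := Finset.mem_filter.mp he
  have hek := hcoord e heJ hbe
  have hde : ¬ b ≤ d + e := fun h => by
    have := h k
    rw [Finsupp.add_apply, hdk] at this
    omega
  have hsum := (mem_map_C_sup_span_monomial_iff _ _ _).mp hg _ hde
  rw [coeff_mul, ← Finset.add_sum_erase _ _ (a := (d, e))
    (Finset.HasAntidiagonal.mem_antidiagonal.mpr rfl)] at hsum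
  refine hdP ((hP e hbe heJ _).mpr ((Ideal.add_mem_iff_left J ?_).mp hsum))
  refine Ideal.sum_mem _ ?_
  rintro ⟨p, q⟩ hpq
  obtain ⟨hpq_ne, hpq⟩ := Finset.mem_erase.mp hpq
  rw [Finset.HasAntidiagonal.mem_antidiagonal] at hpq
  dsimp only at hpq ⊢
  by_cases hqJ : coeff q f ∈ J
  · exact J.mul_mem_left _ hqJ
  have hbq : ¬ b ≤ q := fun h => hde (hpq ▸ h.trans le_add_self)
  by_cases hpP : coeff p g ∈ P
  · exact (hP q hbq hqJ _).mp hpP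
  have hpk : p k = 0 := by
    have h1 := hXf q hqJ k
    have h2 := DFunLike.congr_fun hpq k
    simp only [Finsupp.add_apply, Finsupp.single_eq_same] at h1 h2
    omega
  refine absurd ?_ hpq_ne
  have hpG : p ∈ G := Finset.mem_filter.mpr ⟨mem_support_iff.mpr fun h =>
    hpP (h ▸ P.zero_mem), hpk, hpP⟩
  have hqF : q ∈ F := Finset.mem_filter.mpr ⟨mem_support_iff.mpr fun h =>
    hqJ (h ▸ J.zero_mem), hbq, hqJ⟩
  obtain ⟨rfl, rfl⟩ := huniq hpG hqF hpq
  rfl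

/-- The associated primes of `A[Y] / (J, Y ^ b)` are the ideals `(P, Yₖ)` with `P` an associated
prime of `A / J` and `Yₖ` dividing `Y ^ b`. -/
theorem mem_associatedPrimes_quotient_map_C_sup_span_monomial_iff [IsNoetherianRing A] [Finite τ]
    (J : Ideal A) (b : τ →₀ ℕ) (Q : Ideal (MvPolynomial τ A)) :
    Q ∈ associatedPrimes (MvPolynomial τ A)
        (MvPolynomial τ A ⧸ (J.map C ⊔ Ideal.span {monomial b (1 : A)})) ↔
      ∃ P ∈ associatedPrimes A (A ⧸ J), ∃ k : τ, 1 ≤ b k ∧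
        Q = P.map C ⊔ Ideal.span {(X k : MvPolynomial τ A)} := by
  classical
  simp only [mem_associatedPrimes_quotient_iff]
  constructor
  · rintro ⟨hQ, f, hf⟩
    obtain ⟨f, hf, hP⟩ := exists_colon_coeff_eq_comap hf
    have hbQ : monomial b (1 : A) ∈ Q :=
      (hf _).mpr (Ideal.mul_mem_right _ _
        (Ideal.mem_sup_right (Ideal.mem_span_singleton_self _)))
    obtain ⟨k, hk, hkQ⟩ : ∃ k, 1 ≤ b k ∧ (X k : MvPolynomial τ A) ∈ Q := by
      rw [monomial_eq, C_1, one_mul, Finsupp.prod, Ideal.IsPrime.prod_mem_iff] at hbQ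
      obtain ⟨k, hk, hkQ⟩ := hbQ
      exact ⟨k, Nat.one_le_iff_ne_zero.mpr (Finsupp.mem_support_iff.mp hk),
        hQ.mem_of_pow_mem _ hkQ⟩
    have hne : ∃ e, ¬ b ≤ e ∧ coeff e f ∉ J := by
      by_contra! h
      refine hQ.ne_top ((Ideal.eq_top_iff_one _).mpr ((hf 1).mpr ?_))
      rwa [one_mul, mem_map_C_sup_span_monomial_iff]
    have ⟨e, hbe, heJ⟩ := hne
    refine ⟨Q.comap C, ⟨inferInstance, coeff e f, hP e hbe heJ⟩, k, hk, le_antisymm ?_ ?_⟩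
    · exact fun g hg => mem_map_C_sup_span_X_of_mul_mem ((hf _).mp hkQ) hP hne ((hf _).mp hg)
    · exact sup_le Ideal.map_comap_le ((Ideal.span_singleton_le_iff_mem _).mpr hkQ)
  · rintro ⟨P, ⟨hP, a, ha⟩, k, hk, rfl⟩
    exact ⟨isPrime_map_C_sup_span_X P k, monomial (b - Finsupp.single k 1) a, fun g =>
      (mul_monomial_mem_map_C_sup_span_monomial_iff ha hk g).symm⟩

end PolynomialExtension

section SplitVariables

variable (R : Type*) [CommRing R] (m l : ℕ)

/-- `R[x₁, …, xₘ₊ₗ]` as a polynomial ring in the last `l` variables over `R[x₁, …, xₘ]`. -/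
def splitVariables :
    MvPolynomial (Fin (m + l)) R ≃ₐ[R] MvPolynomial (Fin l) (MvPolynomial (Fin m) R) :=
  (renameEquiv R (finSumFinEquiv.symm.trans (Equiv.sumComm (Fin m) (Fin l)))).trans
    (sumAlgEquiv R (Fin l) (Fin m))

theorem splitVariables_X_castAdd (i : Fin m) :
    splitVariables R m l (X (Fin.castAdd l i)) = C (X i) := by
  simp [splitVariables]

theorem splitVariables_X_natAdd (j : Fin l) :
    splitVariables R m l (X (Fin.natAdd m j)) = X j := by
  simp [splitVariables]

theorem splitVariables_comp_rename (h : m ≤ m + l) :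
    (splitVariables R m l).toRingEquiv.toRingHom.comp
      (rename (Fin.castLE h) :
        MvPolynomial (Fin m) R →ₐ[R] MvPolynomial (Fin (m + l)) R).toRingHom =
      C := by
  refine MvPolynomial.ringHom_ext (fun r => ?_) fun i => ?_
  · have := (splitVariables R m l).commutes r
    simpa [algebraMap_eq] using this
  · change splitVariables R m l (rename _ (X i)) = C (X i)
    rw [rename_X]
    exact splitVariables_X_castAdd R m l i

theorem splitVariables_monomial (b : Fin (m + l) →₀ ℕ) (hb : ∀ i, i.val < m → b i = 0) :
    splitVariables R m l (monomial b 1) =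
      monomial (Finsupp.equivFunOnFinite.symm fun j => b (Fin.natAdd m j)) 1 := by
  rw [monomial_eq, monomial_eq, Finsupp.prod_fintype _ _ (by simp),
    Finsupp.prod_fintype _ _ (by simp), Fin.prod_univ_add]
  have h (i : Fin m) : b (Fin.castAdd l i) = 0 := hb _ i.isLt
  simp [h, splitVariables_X_natAdd]

end SplitVariables

theorem associatedPrimes_quotient_sup_regular_monomial {K : Type*} [Field K] {m n : ℕ}
    (hmn : m < n)
    (J : Ideal (MvPolynomial (Fin m) K)) (hJ : IsMonomialIdeal K J) (hJproper : J ≠ ⊤)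
    -- `u = x^b ≠ 1` a monomial with support in `{x_{m+1},…,x_n}`:
    (b : Fin n →₀ ℕ) (hb : ∀ i : Fin n, i.val < m → b i = 0) (hbne : b ≠ 0) :
    associatedPrimes (MvPolynomial (Fin n) K)
        (MvPolynomial (Fin n) K ⧸
          ((Ideal.map
              (rename (Fin.castLE hmn.le) : MvPolynomial (Fin m) K →ₐ[K] MvPolynomial (Fin n) K) J)
            ⊔ Ideal.span {(monomial b (1 : K) : MvPolynomial (Fin n) K)}))
      = {Q : Ideal (MvPolynomial (Fin n) K) |
          ∃ P' ∈ associatedPrimes (MvPolynomial (Fin m) K) (MvPolynomial (Fin m) K ⧸ J),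
            ∃ k : Fin n, 1 ≤ b k ∧
              Q = (Ideal.map
                    (rename (Fin.castLE hmn.le) :
                      MvPolynomial (Fin m) K →ₐ[K] MvPolynomial (Fin n) K) P')
                  ⊔ Ideal.span {(X k : MvPolynomial (Fin n) K)}} := by
  obtain ⟨l, rfl⟩ := Nat.exists_eq_add_of_le hmn.le
  set ρ : MvPolynomial (Fin m) K →ₐ[K] MvPolynomial (Fin (m + l)) K := rename (Fin.castLE hmn.le)
  let e := (splitVariables K m l).toRingEquiv
  have heρ : e.toRingHom.comp ρ.toRingHom = C := splitVariables_comp_rename K m l hmn.le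
  have hmap (L : Ideal (MvPolynomial (Fin m) K)) (p : MvPolynomial (Fin (m + l)) K) :
      (L.map ρ ⊔ Ideal.span {p}).map e = L.map C ⊔ Ideal.span {e p} := by
    rw [Ideal.map_sup, Ideal.map_span, Set.image_singleton, ← heρ, ← Ideal.map_map]
    rfl
  have hsymm (I : Ideal (MvPolynomial (Fin (m + l)) K)) : (I.map e).map e.symm = I :=
    Ideal.map_of_equiv e
  have hinj : Function.Injective (Ideal.map e) := fun I I' h => by
    have := congrArg (Ideal.map e.symm) h
    rwa [hsymm, hsymm] at this
  have hiff (I Q : Ideal (MvPolynomial (Fin (m + l)) K)) :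
      Q ∈ associatedPrimes _ (_ ⧸ I) ↔ Q.map e ∈ associatedPrimes _ (_ ⧸ I.map e) := by
    refine ⟨map_mem_associatedPrimes_quotient e, fun h => ?_⟩
    have := map_mem_associatedPrimes_quotient e.symm h
    rwa [hsymm, hsymm] at this
  ext Q
  rw [hiff, hmap, show e (monomial b 1) = _ from splitVariables_monomial K m l b hb,
    mem_associatedPrimes_quotient_map_C_sup_span_monomial_iff, Set.mem_ofPred_eq]
  refine exists_congr fun P => and_congr_right fun _ => ⟨?_, ?_⟩
  · rintro ⟨j, hj, hQ⟩
    refine ⟨Fin.natAdd m j, hj, hinj ?_⟩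
    rw [hmap, hQ, show e (X (Fin.natAdd m j)) = _ from splitVariables_X_natAdd K m l j]
  · rintro ⟨k, hk, rfl⟩
    induction k using Fin.addCases with
    | left i => exact absurd (hb _ i.isLt) (Nat.one_le_iff_ne_zero.mp hk)
    | right j =>
      refine ⟨j, hk, ?_⟩
      rw [hmap, show e (X (Fin.natAdd m j)) = _ from splitVariables_X_natAdd K m l j]

end
end
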